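/- arXiv:2507.00384 — 2 statements merged into one kernel-verified Lean document; each statement's English description precedes it below -/
import Mathlib

section
/- Let L be a finite-dimensional Lie algebra over ℂ with radical R and Killing radical K, and let S be a Levi subalgebra of L. Then K ⊆ R, and there exists a ℂ-subspace Z_s of R such that ⁅s, z⁆ ∈ Z_s for all s ∈ S, z ∈ Z_s, and R is the internal direct sum R = Z_s ⊕ K. -/
/-- The Killing radical of a Lie algebra over ℂ: the kernel of the Killing form,
`K = {x ∈ L | κ(x,y) = 0 for all y ∈ L}`. -/
def killingRad (L : Type*) [LieRing L] [LieAlgebra ℂ L] : Submodule ℂ L where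
  carrier := {x : L | ∀ y : L, killingForm ℂ L x y = 0}
  add_mem' := by
    intro a b ha hb y
    rw [map_add, LinearMap.add_apply, ha y, hb y, add_zero]
  zero_mem' := by
    intro y
    rw [map_zero, LinearMap.zero_apply]
  smul_mem' := by
    intro c a ha y
    rw [map_smul, LinearMap.smul_apply, ha y, smul_zero]

open LieAlgebra LieModule Module

attribute [local instance] LieRing.ofAssociativeRing

section

variable {k : Type*} [Field k] [CharZero k]

/-- If a finite-dimensional Lie algebra has a faithful representation with vanishing trace form,
then it is solvable. -/
theorem LieAlgebra.isSolvable_of_traceForm_eq_zero (G V : Type*) [LieRing G] [LieAlgebra k G]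
    [FiniteDimensional k G] [AddCommGroup V] [Module k V] [FiniteDimensional k V]
    [LieRingModule G V] [LieModule k G V]
    (hinj : Function.Injective (toEnd k G V)) (h : traceForm k G V = 0) : IsSolvable G := by
  have module_nilp := isNilpotent_derivedSeries_of_traceForm_eq_zero h
  rw [LieModule.isNilpotent_iff_forall' (R := k)] at module_nilp
  have ring_nilp : LieRing.IsNilpotent (derivedSeries k G 1) := by
    rw [LieAlgebra.isNilpotent_iff_forall (R := k)]
    intro x
    apply LieSubalgebra.isNilpotent_ad_of_isNilpotent_ad
      (derivedSeries k G 1 : LieSubalgebra k G) (x := x)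
    obtain ⟨n, hn⟩ := LieAlgebra.ad_nilpotent_of_nilpotent (R := k) (module_nilp x)
    refine ⟨n, LinearMap.ext fun y ↦ hinj ?_⟩
    have key : ∀ m : ℕ, toEnd k G V ((ad k G (x : G) ^ m) y) =
        (ad k (End k V) (toEnd k G V (x : G)) ^ m) (toEnd k G V y) := by
      intro m
      induction m with
      | zero => rfl
      | succ m ih => rw [pow_succ', pow_succ', End.mul_apply, End.mul_apply, ad_apply, ad_apply,
          LieHom.map_lie, ih]
    rw [LinearMap.zero_apply, map_zero]
    exact (key n).trans (LinearMap.congr_fun hn _)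
  obtain ⟨m, hm⟩ := IsSolvable.solvable k (derivedSeries k G 1)
  rw [LieIdeal.derivedSeries_eq_bot_iff] at hm
  refine IsSolvable.mk (R := k) (k := m + 1) ?_
  rwa [derivedSeries_def, derivedSeriesOfIdeal_add]

/-- On a finite-dimensional representation, the product of the action of `⁅x, r⁆`, with `r` in the
radical, and the action of any element is nilpotent. -/
theorem LieModule.isNilpotent_toEnd_lie_radical_mul [IsAlgClosed k] {L : Type*} [LieRing L]
    [LieAlgebra k L] [FiniteDimensional k L] (V : Type*) [AddCommGroup V] [Module k V]
    [FiniteDimensional k V] [LieRingModule L V] [LieModule k L V]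
    {r : L} (hr : r ∈ radical k L) (x y : L) :
    _root_.IsNilpotent (toEnd k L V ⁅x, r⁆ * toEnd k L V y) := by
  obtain ⟨n, hn⟩ : ∃ n, finrank k V = n := ⟨_, rfl⟩
  induction n using Nat.strong_induction_on generalizing V with
  | _ n ih =>
  obtain hV | hV := subsingleton_or_nontrivial V
  · exact ⟨1, Subsingleton.elim _ _⟩
  obtain ⟨χ, hχ⟩ : ∃ χ : Dual k (radical k L), Nontrivial (weightSpace V χ) :=
    exists_nontrivial_weightSpace_of_isSolvable k (radical k L) V
  let N : LieSubmodule k L V := weightSpaceOfIsLieTower k V χ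
  have hN : ∀ v ∈ N, ⁅r, v⁆ = χ ⟨r, hr⟩ • v := fun v hv ↦
    (mem_weightSpace χ v).mp hv ⟨r, hr⟩
  have hlt : finrank k (V ⧸ N) < n := by
    have h₁ := N.toSubmodule.finrank_quotient_add_finrank
    have h₂ : 0 < finrank k N.toSubmodule := finrank_pos_iff.mpr hχ
    change finrank k (V ⧸ N.toSubmodule) < n
    omega
  obtain ⟨m, hm⟩ := ih _ hlt (V ⧸ N) rfl
  set T := toEnd k L V ⁅x, r⁆ * toEnd k L V y with hT
  have hmk : ∀ (j : ℕ) (v : V), (LieSubmodule.Quotient.mk ((T ^ j) v) : V ⧸ N) =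
      ((toEnd k L (V ⧸ N) ⁅x, r⁆ * toEnd k L (V ⧸ N) y) ^ j) (LieSubmodule.Quotient.mk v) := by
    intro j v
    induction j with
    | zero => rfl
    | succ j ihj =>
      rw [pow_succ', pow_succ', End.mul_apply T, End.mul_apply (_ * _), ← ihj]
      rfl
  refine ⟨m + 1, LinearMap.ext fun v ↦ ?_⟩
  have hmem : (T ^ m) v ∈ N := by
    rw [← LieSubmodule.Quotient.mk_eq_zero', hmk, hm, LinearMap.zero_apply]
  rw [pow_succ', End.mul_apply, hT, End.mul_apply, toEnd_apply_apply, toEnd_apply_apply, lie_lie,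
    hN _ (N.lie_mem hmem), hN _ (N.lie_mem (N.lie_mem hmem)), lie_smul, sub_self,
    LinearMap.zero_apply]

/-- The radical is orthogonal to the derived algebra with respect to the Killing form. -/
theorem LieAlgebra.killingForm_lie_radical_eq_zero [IsAlgClosed k] {L : Type*} [LieRing L]
    [LieAlgebra k L] [FiniteDimensional k L] {r : L} (hr : r ∈ radical k L) (x y : L) :
    killingForm k L ⁅x, r⁆ y = 0 :=
  (LinearMap.isNilpotent_trace_of_isNilpotent
    (isNilpotent_toEnd_lie_radical_mul L hr x y)).eq_zero

/-- On a nontrivial finite-dimensional representation of a semisimple Lie algebra `S`, the Casimir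
operator is a non-nilpotent endomorphism of representations with image in `⁅S, V⁆`. -/
theorem LieModule.exists_not_isNilpotent_commute_toEnd (S : Type*) [LieRing S] [LieAlgebra k S]
    [FiniteDimensional k S] [HasTrivialRadical k S] (V : Type*) [AddCommGroup V] [Module k V]
    [FiniteDimensional k V] [LieRingModule S V] [LieModule k S V] (hV : ¬ IsTrivial S V) :
    ∃ C : End k V, ¬ _root_.IsNilpotent C ∧ (∀ s : S, Commute (toEnd k S V s) C) ∧
      ∀ v, C v ∈ ⁅(⊤ : LieIdeal k S), (⊤ : LieSubmodule k S V)⁆ := by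
  classical
  set φ := toEnd k S V with hφ
  let A : LieIdeal k S := φ.ker
  let J : LieIdeal k S := A.killingCompl
  have hAJ : IsCompl A J := A.isCompl_killingCompl
  have hdec : ∀ s : S, ∃ a j : S, φ a = 0 ∧ j ∈ J ∧ s = a + j := by
    intro s
    have : s ∈ A ⊔ J := by rw [hAJ.sup_eq_top]; trivial
    obtain ⟨a, ha, j, hj, rfl⟩ := LieSubmodule.mem_sup .. |>.mp this
    exact ⟨a, j, (LieHom.mem_ker ..).mp ha, hj, rfl⟩
  have hJinj : ∀ x ∈ J, φ x = 0 → x = 0 := by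
    intro x hx h0
    have : x ∈ A ⊓ J := ⟨(LieHom.mem_ker ..).mpr h0, hx⟩
    rwa [hAJ.inf_eq_bot, LieSubmodule.mem_bot] at this
  let N : LieIdeal k S :=
    { LinearMap.ker (traceForm k S V) with
      lie_mem := by
        intro x m hm
        have hm : traceForm k S V m = 0 := hm
        change traceForm k S V ⁅x, m⁆ = 0
        ext y
        rw [traceForm_apply_lie_apply', hm]; simp }
  have hNJ : N ⊓ J = ⊥ := by
    have : IsSolvable (N ⊓ J : LieIdeal k S) := by
      apply LieAlgebra.isSolvable_of_traceForm_eq_zero (k := k) _ V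
      · refine (injective_iff_map_eq_zero (toEnd k (N ⊓ J : LieIdeal k S) V)).mpr fun x hx ↦ ?_
        exact Subtype.ext (hJinj x x.2.2 hx)
      · ext x y
        exact LinearMap.congr_fun (show traceForm k S V x = 0 from x.2.1) y
    exact HasTrivialRadical.eq_bot_of_isSolvable _
  let B : LinearMap.BilinForm k J := traceForm k J V
  have hBsymm : B.IsSymm := ⟨traceForm_comm k J V⟩
  have hB : B.Nondegenerate := by
    refine hBsymm.isRefl.nondegenerate_iff_separatingLeft.mpr fun x hx ↦ ?_
    have : (x : S) ∈ N ⊓ J := by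
      refine ⟨?_, x.2⟩
      change traceForm k S V x = 0
      ext s
      obtain ⟨a, j, ha, hj, rfl⟩ := hdec s
      rw [map_add]
      have h₁ : traceForm k S V x a = 0 := by
        rw [traceForm_apply_apply, ← hφ, ha, LinearMap.comp_zero, map_zero]
      rw [h₁, zero_add]
      exact hx ⟨j, hj⟩
    rw [hNJ, LieSubmodule.mem_bot] at this
    exact Subtype.ext this
  let b := finBasis k J
  let b' := B.dualBasis hB b
  have hb' : ∀ x : J, x = ∑ j, B x (b j) • b' j := by
    intro x
    conv_lhs => rw [← b'.sum_repr x]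
    simp only [b', LinearMap.BilinForm.dualBasis_repr_apply]
  have hb : ∀ x : J, x = ∑ j, B x (b' j) • b j := by
    intro x
    have hbb : B.dualBasis hB b' = b := LinearMap.BilinForm.dualBasis_dualBasis hB hBsymm b
    conv_lhs => rw [← b.sum_repr x]
    refine Finset.sum_congr rfl fun j _ ↦ ?_
    rw [← LinearMap.BilinForm.dualBasis_repr_apply hB b' x j, hbb]
  let ψ := toEnd k J V
  refine ⟨∑ i, ψ (b i) * ψ (b' i), ?_, ?_, ?_⟩
  · intro hnil
    have h0 := (LinearMap.isNilpotent_trace_of_isNilpotent hnil).eq_zero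
    rw [map_sum] at h0
    have h1 : ∀ i, LinearMap.trace k V (ψ (b i) * ψ (b' i)) = 1 := by
      intro i
      change B (b i) (b' i) = 1
      simp [b', LinearMap.BilinForm.apply_dualBasis_right hB hBsymm]
    simp only [h1, Finset.sum_const, Finset.card_univ, Fintype.card_fin, nsmul_eq_mul, mul_one,
      Nat.cast_eq_zero] at h0
    apply hV
    have hJ0 : ∀ j ∈ J, j = 0 := fun j hj ↦ congrArg Subtype.val
      ((finrank_zero_iff.mp h0).elim (⟨j, hj⟩ : J) 0)
    refine ⟨fun s v ↦ ?_⟩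
    obtain ⟨a, j, ha, hj, rfl⟩ := hdec s
    rw [hJ0 j hj, add_zero, ← toEnd_apply_apply k, ← hφ, ha, LinearMap.zero_apply]
  · intro s
    let D : J → J := fun x ↦ ⁅s, x⁆
    have hD : ∀ x : J, φ s * ψ x = ψ (D x) + ψ x * φ s := by
      intro x
      have : ψ (D x) = ⁅φ s, ψ x⁆ := φ.map_lie s x
      rw [this, Ring.lie_def, sub_add_cancel]
    have hDB : ∀ x y : J, B (D x) y = - B (D y) x := by
      intro x y
      have := traceForm_apply_lie_apply' k S V s x y
      rw [traceForm_comm k S V x] at this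
      exact this
    have hcancel : ∑ i, ψ (D (b i)) * ψ (b' i) + ∑ i, ψ (b i) * ψ (D (b' i)) = 0 := by
      have e₁ : ∀ i, ψ (D (b i)) * ψ (b' i) =
          ∑ j, B (D (b i)) (b' j) • (ψ (b j) * ψ (b' i)) := by
        intro i
        conv_lhs => rw [hb (D (b i))]
        rw [map_sum, Finset.sum_mul]
        exact Finset.sum_congr rfl fun j _ ↦ by rw [map_smul, smul_mul_assoc]
      have e₂ : ∀ i, ψ (b i) * ψ (D (b' i)) =
          ∑ j, B (D (b' i)) (b j) • (ψ (b i) * ψ (b' j)) := by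
        intro i
        conv_lhs => rw [hb' (D (b' i))]
        rw [map_sum, Finset.mul_sum]
        exact Finset.sum_congr rfl fun j _ ↦ by rw [map_smul, mul_smul_comm]
      simp_rw [e₁, e₂]
      rw [Finset.sum_comm, ← Finset.sum_add_distrib]
      refine Finset.sum_eq_zero fun i _ ↦ ?_
      rw [← Finset.sum_add_distrib]
      refine Finset.sum_eq_zero fun j _ ↦ ?_
      rw [hDB (b' i), neg_smul, add_neg_cancel]
    change φ s * _ = _ * φ s
    rw [Finset.mul_sum, Finset.sum_mul, ← sub_eq_zero, ← Finset.sum_sub_distrib, ← hcancel,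
      ← Finset.sum_add_distrib]
    refine Finset.sum_congr rfl fun i _ ↦ ?_
    rw [← mul_assoc, hD, add_mul, mul_assoc (ψ (b i)), hD, mul_add, mul_assoc]
    abel
  · intro v
    rw [LinearMap.sum_apply]
    exact Submodule.sum_mem _ fun i _ ↦
      LieSubmodule.lie_mem_lie (x := (b i : S)) (m := ψ (b' i) v) (LieSubmodule.mem_top _)
        (LieSubmodule.mem_top _)

/-- A finite-dimensional representation `V` of a semisimple Lie algebra `S` is the sum of its
invariants and of `⁅S, V⁆`. -/
theorem LieModule.maxTrivSubmodule_sup_lie_top_eq_top (S : Type*) [LieRing S] [LieAlgebra k S]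
    [FiniteDimensional k S] [HasTrivialRadical k S] (V : Type*) [AddCommGroup V] [Module k V]
    [FiniteDimensional k V] [LieRingModule S V] [LieModule k S V] :
    maxTrivSubmodule k S V ⊔ ⁅(⊤ : LieIdeal k S), (⊤ : LieSubmodule k S V)⁆ = ⊤ := by
  obtain ⟨n, hn⟩ : ∃ n, finrank k V = n := ⟨_, rfl⟩
  induction n using Nat.strong_induction_on generalizing V with
  | _ n ih =>
  by_cases hV : IsTrivial S V
  · rw [(isTrivial_iff_max_triv_eq_top k S V).mp hV, top_sup_eq]
  obtain ⟨C, hC, hcomm, hCmem⟩ := exists_not_isNilpotent_commute_toEnd (k := k) S V hV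
  obtain ⟨m, hm⟩ := Filter.eventually_atTop.mp C.eventually_isCompl_ker_pow_range_pow
  replace hm := hm (m + 1) m.le_succ
  let N : LieSubmodule k S V :=
    { LinearMap.ker (C ^ (m + 1)) with
      lie_mem := by
        intro s v hv
        have hv : (C ^ (m + 1)) v = 0 := hv
        change (C ^ (m + 1)) (toEnd k S V s v) = 0
        rw [← End.mul_apply, ← ((hcomm s).pow_right (m + 1)).eq, End.mul_apply, hv, map_zero] }
  have hlt : finrank k N < n := by
    rw [← hn]
    refine Submodule.finrank_lt (s := N.toSubmodule) fun h ↦ hC ⟨m + 1, ?_⟩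
    exact LinearMap.ker_eq_top.mp h
  have hN := ih _ hlt N rfl
  rw [eq_top_iff]
  intro v _
  obtain ⟨v₀, hv₀, v₁, ⟨w, rfl⟩, rfl⟩ := Submodule.mem_sup.mp
    (hm.sup_eq_top ▸ Submodule.mem_top : v ∈ LinearMap.ker (C ^ (m + 1)) ⊔ _)
  refine add_mem ?_ (LieSubmodule.mem_sup_right ?_)
  · have hmem : (⟨v₀, hv₀⟩ : N) ∈ (⊤ : LieSubmodule k S N) := trivial
    rw [← hN, LieSubmodule.mem_sup] at hmem
    obtain ⟨u, hu, t, ht, hut⟩ := hmem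
    have hv : v₀ = (u : V) + t := (congrArg Subtype.val hut).symm
    rw [hv]
    refine add_mem (LieSubmodule.mem_sup_left ?_) (LieSubmodule.mem_sup_right ?_)
    · rw [mem_maxTrivSubmodule] at hu ⊢
      exact fun s ↦ congrArg Subtype.val (hu s)
    · have := LieSubmodule.mem_map_of_mem (f := N.incl) ht
      rw [LieSubmodule.map_bracket_eq] at this
      exact LieSubmodule.mono_lie_right _ le_top this
  · rw [pow_succ', End.mul_apply]
    exact hCmem _

end

/-- For a finite-dimensional complex Lie algebra `L` with radical `R`, Killing radical `K`
and Levi subalgebra `S`: `K ⊆ R`, and there is an `S`-stable subspace `Z_s ⊆ R` with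
`R = Z_s ⊕ K` (internal direct sum). -/
theorem statement1 (L : Type*) [LieRing L] [LieAlgebra ℂ L] [FiniteDimensional ℂ L]
    (S : LieSubalgebra ℂ L) (hS : LieAlgebra.IsSemisimple ℂ S)
    (hLevi : IsCompl S.toSubmodule (LieAlgebra.radical ℂ L).toSubmodule) :
    killingRad L ≤ (LieAlgebra.radical ℂ L).toSubmodule ∧
    ∃ Zs : Submodule ℂ L,
      Zs ≤ (LieAlgebra.radical ℂ L).toSubmodule ∧
      (∀ s ∈ S, ∀ z ∈ Zs, ⁅s, z⁆ ∈ Zs) ∧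
      Disjoint Zs (killingRad L) ∧
      Zs ⊔ killingRad L = (LieAlgebra.radical ℂ L).toSubmodule := by
  have hKR : killingRad L ≤ (radical ℂ L).toSubmodule := fun x hx ↦
    killingCompl_top_le_radical ℂ L fun y _ ↦ (traceForm_comm ℂ L L y x).trans (hx y)
  refine ⟨hKR, ?_⟩
  let Z := (maxTrivSubmodule ℂ S (radical ℂ L)).toSubmodule.map (radical ℂ L).toSubmodule.subtype
  have hZR : Z ≤ (radical ℂ L).toSubmodule := Submodule.map_subtype_le _ _
  have hSZ : ∀ s ∈ S, ∀ z ∈ Z, ⁅s, z⁆ = 0 := by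
    rintro s hs _ ⟨z, hz, rfl⟩
    exact congrArg Subtype.val ((mem_maxTrivSubmodule ℂ S (radical ℂ L) z).mp hz ⟨s, hs⟩)
  have hlie : ∀ t ∈ ⁅(⊤ : LieIdeal ℂ S), (⊤ : LieSubmodule ℂ S (radical ℂ L))⁆,
      (t : L) ∈ killingRad L := by
    intro t ht
    rw [← LieSubmodule.mem_toSubmodule, LieSubmodule.lieIdeal_oper_eq_linear_span'] at ht
    induction ht using Submodule.span_induction with
    | mem x hx =>
      obtain ⟨s, -, r, -, rfl⟩ := hx
      exact fun y ↦ killingForm_lie_radical_eq_zero r.2 (s : L) y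
    | zero => exact zero_mem _
    | add x y _ _ hx hy => exact add_mem hx hy
    | smul a x _ hx => exact Submodule.smul_mem _ a hx
  have hsup : (radical ℂ L).toSubmodule ≤ Z ⊔ killingRad L := by
    intro r hr
    have hmem : (⟨r, hr⟩ : radical ℂ L) ∈ (⊤ : LieSubmodule ℂ S (radical ℂ L)) := trivial
    rw [← maxTrivSubmodule_sup_lie_top_eq_top, LieSubmodule.mem_sup] at hmem
    obtain ⟨u, hu, t, ht, hut⟩ := hmem
    exact Submodule.mem_sup.mpr ⟨u, ⟨u, hu, rfl⟩, t, hlie t ht, congrArg Subtype.val hut⟩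
  obtain ⟨Q, hQ⟩ := Submodule.exists_isCompl (Z ⊓ killingRad L)
  refine ⟨Z ⊓ Q, inf_le_left.trans hZR, ?_, ?_, le_antisymm ?_ (hsup.trans ?_)⟩
  · intro s hs z hz
    rw [hSZ s hs z hz.1]
    exact zero_mem _
  · rw [disjoint_iff_inf_le, ← hQ.inf_eq_bot]
    exact le_inf (le_inf (inf_le_left.trans inf_le_left) inf_le_right)
      (inf_le_left.trans inf_le_right)
  · exact sup_le (inf_le_left.trans hZR) hKR
  · refine sup_le ?_ le_sup_right
    have hZ : Z = Z ⊓ killingRad L ⊔ Z ⊓ Q := by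
      rw [inf_comm Z Q, ← sup_inf_assoc_of_le _ inf_le_left, hQ.sup_eq_top, top_inf_eq]
    exact hZ.le.trans (sup_le (inf_le_right.trans le_sup_right) le_sup_left)
end

section
/- Let L be a finite-dimensional Lie algebra over ℂ with radical R and Killing radical K, let S be a Levi subalgebra of L, and let Z_s ⊆ R be a subspace with ⁅S, Z_s⁆ ⊆ Z_s and R = Z_s ⊕ K (internal direct sum). Then ⁅z, z'⁆ ∈ K for all z, z' ∈ Z_s, and ⁅s, z⁆ = 0 for all s ∈ S, z ∈ Z_s. -/
open LieModule in
/-- On a weight space of an ideal `I`, stable under `L` by Lie's lemma, commutators `⁅x, r⁆` with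
`r ∈ I` act as zero. -/
lemma lie_lie_eq_zero_of_mem_weightSpace {k L V : Type*} [Field k] [CharZero k]
    [LieRing L] [LieAlgebra k L] [AddCommGroup V] [Module k V] [LieRingModule L V]
    [LieModule k L V] [FiniteDimensional k V] (I : LieIdeal k L) (χ : Module.Dual k I)
    (x : L) (r : I) {v : V} (hv : v ∈ weightSpace V χ) : ⁅⁅x, (r : L)⁆, v⁆ = 0 := by
  have hxv : ⁅x, v⁆ ∈ weightSpace V χ := (weightSpaceOfIsLieTower (L := L) k V χ).lie_mem hv
  rw [mem_weightSpace] at hv hxv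
  have h₁ : ⁅(r : L), ⁅x, v⁆⁆ = χ r • ⁅x, v⁆ := hxv r
  have h₂ : ⁅(r : L), v⁆ = χ r • v := hv r
  rw [lie_lie, h₁, h₂, lie_smul, sub_self]

open LieModule in
/-- If `r` lies in a solvable ideal, then `⁅x, r⁆` composed with the action of any element is
nilpotent on every finite-dimensional module. -/
lemma isNilpotent_toEnd_lie_comp_toEnd {k L V : Type*} [Field k] [CharZero k] [IsAlgClosed k]
    [LieRing L] [LieAlgebra k L] [AddCommGroup V] [Module k V] [LieRingModule L V]
    [LieModule k L V] [FiniteDimensional k V] (I : LieIdeal k L) [LieAlgebra.IsSolvable I]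
    (x y : L) (r : I) :
    IsNilpotent (toEnd k L V ⁅x, (r : L)⁆ ∘ₗ toEnd k L V y) := by
  induction hn : Module.finrank k V using Nat.strong_induction_on generalizing V with
  | _ n ih =>
  obtain _ | _ := subsingleton_or_nontrivial V
  · exact ⟨1, Subsingleton.elim _ _⟩
  obtain ⟨χ, hχ⟩ := exists_nontrivial_weightSpace_of_isSolvable k I V
  let W : LieSubmodule k L V := weightSpaceOfIsLieTower k V χ
  have : Nontrivial W.toSubmodule := hχ
  have hlt : Module.finrank k (V ⧸ W) < n := by
    have h₁ := W.toSubmodule.finrank_quotient_add_finrank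
    have h₂ : 0 < Module.finrank k W.toSubmodule := Module.finrank_pos
    change Module.finrank k (V ⧸ W.toSubmodule) < n
    lia
  obtain ⟨m, hm⟩ := ih _ hlt (V := V ⧸ W) rfl
  set f := toEnd k L V ⁅x, (r : L)⁆ ∘ₗ toEnd k L V y
  have hmk (j : ℕ) (v : V) : LieSubmodule.Quotient.mk' W ((f ^ j) v) =
      ((toEnd k L (V ⧸ W) ⁅x, (r : L)⁆ ∘ₗ toEnd k L (V ⧸ W) y) ^ j)
        (LieSubmodule.Quotient.mk' W v) := by
    induction j with
    | zero => rfl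
    | succ j hj =>
      rw [pow_succ', pow_succ', Module.End.mul_apply, Module.End.mul_apply, ← hj]
      rfl
  refine ⟨m + 1, LinearMap.ext fun v ↦ ?_⟩
  have hmem : (f ^ m) v ∈ W := by
    rw [← LieSubmodule.Quotient.mk_eq_zero, hmk, hm, LinearMap.zero_apply]
  rw [pow_succ', Module.End.mul_apply]
  exact lie_lie_eq_zero_of_mem_weightSpace I χ x r (W.lie_mem hmem)

lemma lie_mem_killingRad {L : Type*} [LieRing L] [LieAlgebra ℂ L] [FiniteDimensional ℂ L]
    (x : L) {r : L} (hr : r ∈ LieAlgebra.radical ℂ L) : ⁅x, r⁆ ∈ killingRad L := fun y ↦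
  (LinearMap.isNilpotent_trace_of_isNilpotent
    (isNilpotent_toEnd_lie_comp_toEnd (V := L) (LieAlgebra.radical ℂ L) x y ⟨r, hr⟩)).eq_zero

/-- With `R = Z_s ⊕ K` an `S`-stable decomposition of the radical (`S` a Levi subalgebra):
`⁅Z_s, Z_s⁆ ⊆ K` and `⁅S, Z_s⁆ = 0`. -/
theorem statement3 (L : Type*) [LieRing L] [LieAlgebra ℂ L] [FiniteDimensional ℂ L]
    (S : LieSubalgebra ℂ L) (hS : LieAlgebra.IsSemisimple ℂ S)
    (hLevi : IsCompl S.toSubmodule (LieAlgebra.radical ℂ L).toSubmodule)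
    (Zs : Submodule ℂ L)
    (hZsR : Zs ≤ (LieAlgebra.radical ℂ L).toSubmodule)
    (hSZs : ∀ s ∈ S, ∀ z ∈ Zs, ⁅s, z⁆ ∈ Zs)
    (hdisj : Disjoint Zs (killingRad L))
    (hsum : Zs ⊔ killingRad L = (LieAlgebra.radical ℂ L).toSubmodule) :
    (∀ z ∈ Zs, ∀ z' ∈ Zs, ⁅z, z'⁆ ∈ killingRad L) ∧
    (∀ s ∈ S, ∀ z ∈ Zs, ⁅s, z⁆ = 0) := by
  refine ⟨fun z _ z' hz' ↦ lie_mem_killingRad z (hZsR hz'), fun s hs z hz ↦ ?_⟩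
  exact Submodule.disjoint_def.mp hdisj _ (hSZs s hs z hz) (lie_mem_killingRad s (hZsR hz))
end
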